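/- arXiv:math/0209218 — 2 statements merged into one kernel-verified Lean document; each statement's English description precedes it below -/
import Mathlib

section
/- Let N ≡ 2 (mod 4) with N ≥ 2, let m be an odd integer, and set q = exp(2πi/N). Then the Gauss sum G(N,m) = Σ_{j=0}^{N−1} q^{j(j+m)} equals (1+i)·√N·exp(−πi m²/(2N)), where i is the imaginary unit. In particular G(N,m) ≠ 0. -/
open Complex Finset

/-- `qp N r = exp(2πi r / N)`, i.e. `q^r` for `q = exp(2πi/N)`. -/
noncomputable def qp (N : ℕ) (r : ℚ) : ℂ :=
  Complex.exp (2 * (Real.pi : ℂ) * Complex.I * (r : ℂ) / (N : ℂ))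

/-- The Weyl vector of `osp(1|2n)`: `ρ_j = n - j + 1/2` for `j = 1, …, n`
(0-indexed: `ρ j = n - j - 1/2`). -/
def rhoV (n : ℕ) : Fin n → ℚ := fun j => (n : ℚ) - (j : ℚ) - 1/2

/-- The standard dot product on `ℚ^n`. -/
def dotp {n : ℕ} (x y : Fin n → ℚ) : ℚ := ∑ j, x j * y j

/-- Coercion of an integer vector to a rational vector. -/
def intC {n : ℕ} (lam : Fin n → ℤ) : Fin n → ℚ := fun j => (lam j : ℚ)

/-- Coercion of an element of `X_M = {0,…,M-1}^n` to a rational vector. -/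
def finC {n M : ℕ} (mu : Fin n → Fin M) : Fin n → ℚ := fun j => ((mu j : ℕ) : ℚ)

/-- The `j`-th standard basis vector of `ℚ^n`. -/
def stdB (n : ℕ) (j : Fin n) : Fin n → ℚ := fun l => if l = j then 1 else 0

/-- The hyperoctahedral group (Weyl group of `osp(1|2n)`): a permutation with signs. -/
abbrev HypOct (n : ℕ) := Equiv.Perm (Fin n) × (Fin n → ℤˣ)

/-- Action of the hyperoctahedral group on `ℚ^n` by signed permutation of coordinates. -/
def Wact {n : ℕ} (σ : HypOct n) (x : Fin n → ℚ) : Fin n → ℚ :=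
  fun j => ((σ.2 j : ℤ) : ℚ) * x (σ.1⁻¹ j)

/-- `ε'(σ) = sgn(π) · ∏_j s_j` for `σ = (π, s)`. -/
def epsW {n : ℕ} (σ : HypOct n) : ℤˣ :=
  Equiv.Perm.sign σ.1 * ∏ j, σ.2 j

/-- `S'_{λ,μ} = Σ_{σ∈W} ε'(σ) q^{2(λ+ρ, σ(μ+ρ))}` (for rational vectors `λ, μ`). -/
noncomputable def Sprime (n N : ℕ) (lam mu : Fin n → ℚ) : ℂ :=
  ∑ σ : HypOct n,
    ((epsW σ : ℤ) : ℂ) * qp N (2 * dotp (lam + rhoV n) (Wact σ (mu + rhoV n)))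

/-- `Q_μ = Σ_{σ∈W} ε'(σ) q^{2(ρ, σ(μ+ρ))}`. -/
noncomputable def Qmu (n N : ℕ) (mu : Fin n → ℤ) : ℂ :=
  ∑ σ : HypOct n,
    ((epsW σ : ℤ) : ℂ) * qp N (2 * dotp (rhoV n) (Wact σ (intC mu + rhoV n)))

/-- Gauss sum `G(N,m) = Σ_{j=0}^{N-1} q^{j(j+m)}` with `q = exp(2πi/N)`. -/
noncomputable def GaussG (N : ℕ) (m : ℤ) : ℂ :=
  ∑ j : Fin N, qp N ((j : ℚ) * ((j : ℚ) + (m : ℚ)))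

/-- `Σ_{μ ∈ X_M} q^{(μ, μ+2ρ)}` where `q = exp(2πi/N)`. -/
noncomputable def sumX (n N M : ℕ) : ℂ :=
  ∑ mu : Fin n → Fin M, qp N (dotp (finC mu) (finC mu + 2 • rhoV n))

/-- `Σ_{λ ∈ X_M} q^{(λ,λ)} S'_{λ,μ}` where `q = exp(2πi/N)`. -/
noncomputable def sumXS (n N M : ℕ) (mu : Fin n → ℤ) : ℂ :=
  ∑ lam : Fin n → Fin M, qp N (dotp (finC lam) (finC lam)) * Sprime n N (finC lam) (intC mu)
noncomputable def PP (q : ℂ) (n : ℕ) : ℂ := ∏ i ∈ Finset.range n, (1 - q ^ (i + 1))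

noncomputable def gg (q : ℂ) (n : ℕ) : ℂ :=
  ∑ p ∈ Finset.HasAntidiagonal.antidiagonal n, (-1 : ℂ) ^ p.1 / (PP q p.1 * PP q p.2)

lemma PP_succ (q : ℂ) (n : ℕ) : PP q (n + 1) = PP q n * (1 - q ^ (n + 1)) := by
  simp [PP, Finset.prod_range_succ]

lemma PP_zero (q : ℂ) : PP q 0 = 1 := by simp [PP]

lemma one_sub_ne (q : ℂ) (M : ℕ) (hq : IsPrimitiveRoot q M) (n : ℕ) (h : n + 1 < M) :
    1 - q ^ (n + 1) ≠ 0 := by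
  intro h0
  exact hq.pow_ne_one_of_pos_of_lt (Nat.succ_ne_zero n) h (sub_eq_zero.mp h0).symm

lemma PP_ne (q : ℂ) (M : ℕ) (hq : IsPrimitiveRoot q M) (n : ℕ) (h : n < M) :
    PP q n ≠ 0 := by
  rw [PP, Finset.prod_ne_zero_iff]
  intro i hi
  rw [Finset.mem_range] at hi
  exact one_sub_ne q M hq i (by omega)

lemma term_one (q : ℂ) (M : ℕ) (hq : IsPrimitiveRoot q M) (n : ℕ) (h : n + 1 < M) (x : ℂ) :
    (1 - q ^ (n + 1)) * (x / PP q (n + 1)) = x / PP q n := by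
  have h1 := one_sub_ne q M hq n h
  have h2 := PP_ne q M hq n (by omega)
  rw [PP_succ]
  field_simp

/-- removing a factor `1 - q^b` lowers the second index -/
lemma lower_snd (q : ℂ) (M : ℕ) (hq : IsPrimitiveRoot q M) (n : ℕ) (h : n + 1 < M) :
    ∑ p ∈ Finset.HasAntidiagonal.antidiagonal (n + 1), (1 - q ^ p.2) * ((-1 : ℂ) ^ p.1 / (PP q p.1 * PP q p.2))
      = gg q n := by
  rw [Finset.Nat.sum_antidiagonal_succ', gg]
  simp only [pow_zero, sub_self, zero_mul, zero_add]
  refine Finset.sum_congr rfl fun p hp => ?_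
  rw [Finset.HasAntidiagonal.mem_antidiagonal] at hp
  rw [← div_div, term_one q M hq _ (by omega), div_div]

lemma lower_fst (q : ℂ) (M : ℕ) (hq : IsPrimitiveRoot q M) (n : ℕ) (h : n + 1 < M) :
    ∑ p ∈ Finset.HasAntidiagonal.antidiagonal (n + 1),
      q ^ p.2 * (1 - q ^ p.1) * ((-1 : ℂ) ^ p.1 / (PP q p.1 * PP q p.2))
      = - ∑ p ∈ Finset.HasAntidiagonal.antidiagonal n, q ^ p.2 * ((-1 : ℂ) ^ p.1 / (PP q p.1 * PP q p.2)) := by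
  rw [Finset.Nat.sum_antidiagonal_succ, ← Finset.sum_neg_distrib]
  simp only [pow_zero, sub_self, zero_mul, mul_zero, zero_add]
  refine Finset.sum_congr rfl fun p hp => ?_
  rw [Finset.HasAntidiagonal.mem_antidiagonal] at hp
  rw [mul_comm (PP q (p.1 + 1)), ← div_div, mul_assoc, term_one q M hq _ (by omega), div_div,
    mul_comm (PP q p.2), pow_succ]
  ring

lemma gg_rec (q : ℂ) (M : ℕ) (hq : IsPrimitiveRoot q M) (n : ℕ) (h : n + 2 < M) :
    (1 - q ^ (n + 2)) * gg q (n + 2) = gg q n := by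
  have e1 : (1 - q ^ (n + 2)) * gg q (n + 2) =
      ∑ p ∈ Finset.HasAntidiagonal.antidiagonal (n + 1 + 1),
        (1 - q ^ p.2) * ((-1 : ℂ) ^ p.1 / (PP q p.1 * PP q p.2)) +
      ∑ p ∈ Finset.HasAntidiagonal.antidiagonal (n + 1 + 1),
        q ^ p.2 * (1 - q ^ p.1) * ((-1 : ℂ) ^ p.1 / (PP q p.1 * PP q p.2)) := by
    rw [gg, Finset.mul_sum, ← Finset.sum_add_distrib]
    refine Finset.sum_congr rfl fun p hp => ?_
    rw [Finset.HasAntidiagonal.mem_antidiagonal] at hp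
    rw [← hp, pow_add]
    ring
  rw [e1, lower_snd q M hq _ (by omega), lower_fst q M hq _ (by omega),
    ← lower_snd q M hq n (by omega), gg, ← sub_eq_add_neg, ← Finset.sum_sub_distrib]
  refine Finset.sum_congr rfl fun p hp => ?_
  ring

lemma gg_even (q : ℂ) (M : ℕ) (hq : IsPrimitiveRoot q M) (h : ℕ) (hh : 2 * h < M) :
    PP q (2 * h) * gg q (2 * h) = ∏ k ∈ Finset.range h, (1 - q ^ (2 * k + 1)) := by
  induction h with
  | zero => simp [gg, PP]
  | succ k ih =>
    rw [Finset.prod_range_succ, ← ih (by omega), ← gg_rec q M hq (2 * k) (by omega)]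
    rw [show 2 * (k + 1) = 2 * k + 1 + 1 by ring, PP_succ, PP_succ]
    ring

lemma PP_split (q : ℂ) (n : ℕ) (hq : IsPrimitiveRoot q (n + 1)) (a : ℕ) :
    ∀ b, a + b = n → PP q n * q ^ (∑ i ∈ Finset.range (a + 1), i) = (-1) ^ a * PP q a * PP q b := by
  induction a with
  | zero => intro b hb; simp at hb; simp [hb, PP_zero]
  | succ a ih =>
    intro b hb
    have := ih (b + 1) (by omega)
    have h1 : q ^ (a + 1) * q ^ (b + 1) = 1 := by
      rw [← pow_add, show a + 1 + (b + 1) = n + 1 by omega, hq.pow_eq_one]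
    rw [Finset.sum_range_succ, pow_add, ← mul_assoc, this, PP_succ, PP_succ]
    linear_combination (-(-1) ^ a * PP q a * PP q b) * h1

lemma gauss_prod (q : ℂ) (h : ℕ) (hq : IsPrimitiveRoot q (2 * h + 1)) :
    ∑ a ∈ Finset.range (2 * h + 1), (q⁻¹) ^ (∑ i ∈ Finset.range (a + 1), i)
      = ∏ k ∈ Finset.range h, (1 - q ^ (2 * k + 1)) := by
  rw [← gg_even q _ hq h (by omega), gg, Finset.mul_sum,
    Finset.Nat.sum_antidiagonal_eq_sum_range_succ_mk]
  refine Finset.sum_congr rfl fun a ha => ?_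
  rw [Finset.mem_range] at ha
  have := PP_split q (2 * h) hq a (2 * h - a) (by omega)
  have h1 := PP_ne q _ hq a ha
  have h2 := PP_ne q _ hq (2 * h - a) (by omega)
  have h3 : q ≠ 0 := hq.ne_zero (by omega)
  have h4 : ((-1 : ℂ) ^ a) * (-1) ^ a = 1 := by rw [← mul_pow]; simp
  rw [inv_pow]
  field_simp
  linear_combination (-(-1) ^ a) * this - PP q a * PP q (2 * h - a) * h4

lemma one_sub_exp (t : ℝ) : 1 - Complex.exp (-(2 * t * Complex.I)) =
    ((2 * Real.sin t : ℝ) : ℂ) * Complex.exp ((Real.pi / 2 - t) * Complex.I) := by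
  have e1 : Complex.exp ((Real.pi / 2 - t) * Complex.I) =
      Complex.I * Complex.exp (-(t * Complex.I)) := by
    rw [sub_mul, sub_eq_add_neg, Complex.exp_add, Complex.exp_pi_div_two_mul_I]
  have e2 : Complex.exp (-(2 * t * Complex.I)) = Complex.exp (-(t * Complex.I)) ^ 2 := by
    rw [← Complex.exp_nat_mul]; congr 1; push_cast; ring
  have e3 : Complex.exp (t * Complex.I) * Complex.exp (-(t * Complex.I)) = 1 := by
    rw [← Complex.exp_add]; simp
  rw [e1, e2]
  push_cast
  rw [Complex.sin, neg_mul]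
  linear_combination (-Complex.exp (-(t * Complex.I)) ^ 2 +
    Complex.exp (t * Complex.I) * Complex.exp (-(t * Complex.I))) * Complex.I_sq - e3

noncomputable def qq (h : ℕ) : ℂ := Complex.exp (-(2 * Real.pi * Complex.I / ((2 * h + 1 : ℕ) : ℂ)))

lemma qq_prim (h : ℕ) : IsPrimitiveRoot (qq h) (2 * h + 1) := by
  have := (Complex.isPrimitiveRoot_exp (2 * h + 1) (by omega)).inv
  rwa [← Complex.exp_neg] at this

noncomputable def tt (h k : ℕ) : ℝ := Real.pi * (2 * k + 1) / (2 * h + 1)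

lemma qq_odd (h k : ℕ) : 1 - qq h ^ (2 * k + 1) =
    ((2 * Real.sin (tt h k) : ℝ) : ℂ) * Complex.exp ((Real.pi / 2 - tt h k) * Complex.I) := by
  rw [← one_sub_exp, qq, ← Complex.exp_nat_mul, tt]
  congr 2
  push_cast
  ring

lemma qq_even (h k : ℕ) (hk : k < h) : 1 - qq h ^ (2 * (h - 1 - k) + 2) =
    ((2 * Real.sin (tt h k) : ℝ) : ℂ) * Complex.exp (-((Real.pi / 2 - tt h k) * Complex.I)) := by
  have e : qq h ^ (2 * (h - 1 - k) + 2) = (starRingEnd ℂ) (qq h ^ (2 * k + 1)) := by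
    have h1 : qq h ^ (2 * (h - 1 - k) + 2) * qq h ^ (2 * k + 1) = 1 := by
      rw [← pow_add, show 2 * (h - 1 - k) + 2 + (2 * k + 1) = 2 * h + 1 by omega,
        (qq_prim h).pow_eq_one]
    have h2 : ‖qq h ^ (2 * k + 1)‖ = 1 := by
      rw [norm_pow, (qq_prim h).norm'_eq_one (by omega), one_pow]
    rw [← Complex.inv_eq_conj h2]
    exact eq_inv_of_mul_eq_one_left h1
  have := congrArg (starRingEnd ℂ) (qq_odd h k)
  rw [e]
  rw [map_sub, map_one, map_mul, Complex.conj_ofReal, ← Complex.exp_conj] at this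
  rw [this]
  congr 2
  have h2 : (starRingEnd ℂ) 2 = 2 := Complex.conj_ofNat 2
  simp [h2]

lemma prod_even_odd (f : ℕ → ℂ) (h : ℕ) : ∏ i ∈ Finset.range (2 * h), f i =
    (∏ k ∈ Finset.range h, f (2 * k)) * ∏ k ∈ Finset.range h, f (2 * k + 1) := by
  induction h with
  | zero => simp
  | succ n ih =>
    rw [show 2 * (n + 1) = 2 * n + 1 + 1 by ring, Finset.prod_range_succ, Finset.prod_range_succ,
      ih, Finset.prod_range_succ, Finset.prod_range_succ]
    ring

lemma sin_prod (h : ℕ) : ∏ k ∈ Finset.range h, (2 * Real.sin (tt h k)) = Real.sqrt (2 * h + 1) := by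
  have hpos : 0 ≤ ∏ k ∈ Finset.range h, (2 * Real.sin (tt h k)) := by
    refine Finset.prod_nonneg fun k hk => ?_
    rw [Finset.mem_range] at hk
    have hk' : (k : ℝ) + 1 ≤ h := by exact_mod_cast hk
    refine mul_nonneg zero_le_two (Real.sin_nonneg_of_nonneg_of_le_pi ?_ ?_)
    · rw [tt]; positivity
    · rw [tt, div_le_iff₀ (by positivity)]
      exact mul_le_mul_of_nonneg_left (by linarith) Real.pi_pos.le
  symm
  rw [Real.sqrt_eq_iff_mul_self_eq (by positivity) hpos]
  have h1 := (qq_prim h).prod_one_sub_pow_eq_order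
  rw [prod_even_odd] at h1
  rw [← Finset.prod_range_reflect (fun k => 1 - qq h ^ (2 * k + 1 + 1)), ← Finset.prod_mul_distrib]
    at h1
  have h2 : ∏ k ∈ Finset.range h, ((1 - qq h ^ (2 * k + 1)) * (1 - qq h ^ (2 * (h - 1 - k) + 1 + 1)))
      = ∏ k ∈ Finset.range h, (((2 * Real.sin (tt h k)) * (2 * Real.sin (tt h k)) : ℝ) : ℂ) := by
    refine Finset.prod_congr rfl fun k hk => ?_
    rw [Finset.mem_range] at hk
    rw [qq_odd, qq_even h k hk]
    have e3 : Complex.exp ((Real.pi / 2 - tt h k) * Complex.I) *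
      Complex.exp (-((Real.pi / 2 - tt h k) * Complex.I)) = 1 := by
      rw [← Complex.exp_add]; simp
    push_cast
    linear_combination (2 * Complex.sin (tt h k)) ^ 2 * e3
  rw [h2, ← Complex.ofReal_prod, Finset.prod_mul_distrib] at h1
  apply Complex.ofReal_injective
  rw [h1]
  push_cast
  ring

lemma angle_sum (h n : ℕ) : ∑ k ∈ Finset.range n, (Real.pi / 2 - (tt h k : ℂ)) * Complex.I =
    Real.pi * (n / 2 - n ^ 2 / (2 * h + 1)) * Complex.I := by
  induction n with
  | zero => simp
  | succ n ih =>
    rw [Finset.sum_range_succ, ih, tt]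
    push_cast
    ring

lemma prod_eval (h : ℕ) : ∏ k ∈ Finset.range h, (1 - qq h ^ (2 * k + 1)) =
    (Real.sqrt (2 * h + 1) : ℂ) *
      Complex.exp (Real.pi * Complex.I * h / (2 * (2 * h + 1))) := by
  rw [Finset.prod_congr rfl fun k _ => qq_odd h k, Finset.prod_mul_distrib, ← Complex.ofReal_prod,
    sin_prod, ← Complex.exp_sum, angle_sum]
  congr 2
  have : (2 * h + 1 : ℂ) ≠ 0 := by exact_mod_cast Nat.succ_ne_zero (2 * h)
  have e : (h : ℂ) / 2 - h ^ 2 / (2 * h + 1) = h / (2 * (2 * h + 1)) := by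
    rw [div_sub_div _ _ two_ne_zero this]
    congr 1
    ring
  rw [e]
  ring

/-- the completed-square summand -/
noncomputable def FF (N : ℕ) (x : ℤ) : ℂ :=
  Complex.exp (2 * Real.pi * Complex.I * (x : ℂ) ^ 2 / (4 * N))

lemma FF_period (N : ℕ) (hN : N ≠ 0) (x : ℤ) :
    FF N (x + 2 * N) = FF N x := by
  have : (N : ℂ) ≠ 0 := by exact_mod_cast hN
  rw [FF, FF, Complex.exp_eq_exp_iff_exists_int]
  refine ⟨x + N, ?_⟩
  push_cast
  field_simp
  ring

lemma G_FF (N : ℕ) (hN : N ≠ 0) (m : ℤ) :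
    GaussG N m = (∑ j ∈ Finset.range N, FF N (2 * j + m)) *
      Complex.exp (-((Real.pi : ℂ) * Complex.I * (m : ℂ) ^ 2) / (2 * (N : ℂ))) := by
  have : (N : ℂ) ≠ 0 := by exact_mod_cast hN
  rw [GaussG, Finset.sum_mul,
    ← Fin.sum_univ_eq_sum_range (fun j => FF N (2 * j + m) *
      Complex.exp (-((Real.pi : ℂ) * Complex.I * (m : ℂ) ^ 2) / (2 * (N : ℂ))))]
  refine Finset.sum_congr rfl fun j _ => ?_
  rw [qp, FF, ← Complex.exp_add]
  congr 1
  push_cast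
  field_simp
  ring

noncomputable def SS (N : ℕ) (m : ℤ) : ℂ := ∑ j ∈ Finset.range N, FF N (2 * j + m)

lemma SS_step (N : ℕ) (hN : N ≠ 0) (m : ℤ) :
    SS N (m + 2) = SS N m := by
  have h1 := Finset.sum_range_succ (fun j : ℕ => FF N (2 * j + m)) N
  rw [Finset.sum_range_succ'] at h1
  have h2 := FF_period N hN m
  have h3 : SS N (m + 2) = ∑ j ∈ Finset.range N, FF N (2 * ((j + 1 : ℕ) : ℤ) + m) := by
    refine Finset.sum_congr rfl fun j _ => ?_
    congr 1
    push_cast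
    ring
  rw [h3, SS]
  rw [add_comm (2 * (N : ℤ)) m, h2] at h1
  simpa using h1

lemma SS_one (N : ℕ) (hN : N ≠ 0) (k : ℤ) : SS N (2 * k + 1) = SS N 1 := by
  induction k using Int.induction_on with
  | zero => simp
  | succ k ih =>
    rw [← ih, ← SS_step N hN (2 * (k : ℤ) + 1)]
    congr 1
  | pred k ih =>
    rw [← ih, ← SS_step N hN (2 * (-(k : ℤ) - 1) + 1)]
    congr 1
    ring

lemma tri (j : ℕ) : ((∑ i ∈ Finset.range (j + 1), i : ℕ) : ℂ) = j * (j + 1) / 2 := by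
  induction j with
  | zero => simp
  | succ j ih =>
    rw [Finset.sum_range_succ]
    push_cast at ih ⊢
    rw [ih]
    ring

lemma G_one (h : ℕ) : GaussG (2 * (2 * h + 1)) 1 =
    2 * ∑ a ∈ Finset.range (2 * h + 1), ((qq h)⁻¹) ^ (∑ i ∈ Finset.range (a + 1), i) := by
  have hM : (2 * h + 1 : ℂ) ≠ 0 := by exact_mod_cast Nat.succ_ne_zero (2 * h)
  have key : ∀ j : ℕ, qp (2 * (2 * h + 1)) ((j : ℚ) * ((j : ℚ) + ((1 : ℤ) : ℚ))) =
      ((qq h)⁻¹) ^ (∑ i ∈ Finset.range (j + 1), i) := by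
    intro j
    rw [qp, qq, ← Complex.exp_neg, ← Complex.exp_nat_mul, tri]
    congr 1
    push_cast
    field_simp
  have per : ∀ j : ℕ, ((qq h)⁻¹) ^ (∑ i ∈ Finset.range (2 * h + 1 + j + 1), i) =
      ((qq h)⁻¹) ^ (∑ i ∈ Finset.range (j + 1), i) := by
    intro j
    have e : ∑ i ∈ Finset.range (2 * h + 1 + j + 1), i =
        ∑ i ∈ Finset.range (j + 1), i + (2 * h + 1) * (j + h + 1) := by
      have : ((∑ i ∈ Finset.range (2 * h + 1 + j + 1), i : ℕ) : ℂ) =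
        ((∑ i ∈ Finset.range (j + 1), i + (2 * h + 1) * (j + h + 1) : ℕ) : ℂ) := by
        rw [Nat.cast_add, tri, tri]
        push_cast
        ring
      exact_mod_cast this
    rw [e, pow_add, pow_mul, (qq_prim h).inv.pow_eq_one, one_pow, mul_one]
  rw [GaussG, Fin.sum_univ_eq_sum_range
    (fun j : ℕ => qp (2 * (2 * h + 1)) ((j : ℚ) * ((j : ℚ) + ((1 : ℤ) : ℚ)))),
    Finset.sum_congr rfl fun j _ => key j, two_mul (2 * h + 1), Finset.sum_range_add,
    Finset.sum_congr rfl fun j _ => per j]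
  ring

lemma SS_val (h : ℕ) : SS (2 * (2 * h + 1)) 1 =
    (1 + Complex.I) * (Real.sqrt ((2 * (2 * h + 1) : ℕ) : ℝ) : ℂ) := by
  have hM : (2 * h + 1 : ℂ) ≠ 0 := by exact_mod_cast Nat.succ_ne_zero (2 * h)
  have h1 := G_FF (2 * (2 * h + 1)) (by omega) 1
  rw [G_one, gauss_prod _ h (qq_prim h), prod_eval] at h1
  set E := Complex.exp (-((Real.pi : ℂ) * Complex.I * ((1 : ℤ) : ℂ) ^ 2) /
    (2 * ((2 * (2 * h + 1) : ℕ) : ℂ))) with hE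
  have hE0 : E ≠ 0 := Complex.exp_ne_zero _
  have hfour : (4 : ℂ) ≠ 0 := by norm_num
  have h2 : Complex.exp (Real.pi * Complex.I * h / (2 * (2 * h + 1))) =
      Complex.exp (Real.pi / 4 * Complex.I) * E := by
    rw [hE, ← Complex.exp_add]
    congr 1
    push_cast
    rw [div_mul_eq_mul_div, div_add_div _ _ hfour (mul_ne_zero two_ne_zero
      (mul_ne_zero two_ne_zero hM)), div_eq_div_iff (mul_ne_zero two_ne_zero hM)
      (mul_ne_zero hfour (mul_ne_zero two_ne_zero (mul_ne_zero two_ne_zero hM)))]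
    ring
  have h3 : Complex.exp (Real.pi / 4 * Complex.I) = (Real.sqrt 2 : ℂ) / 2 * (1 + Complex.I) := by
    rw [Complex.exp_mul_I]
    have c : Complex.cos (Real.pi / 4) = (Real.sqrt 2 : ℂ) / 2 := by
      have := congrArg Complex.ofReal Real.cos_pi_div_four
      push_cast at this
      exact this
    have s : Complex.sin (Real.pi / 4) = (Real.sqrt 2 : ℂ) / 2 := by
      have := congrArg Complex.ofReal Real.sin_pi_div_four
      push_cast at this
      exact this
    rw [c, s]
    ring
  have h4 : (Real.sqrt ((2 * (2 * h + 1) : ℕ) : ℝ) : ℂ) =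
      (Real.sqrt 2 : ℂ) * (Real.sqrt (2 * h + 1) : ℂ) := by
    rw [← Complex.ofReal_mul, ← Real.sqrt_mul zero_le_two]
    push_cast
    rfl
  rw [h2, h3] at h1
  rw [h4]
  apply mul_right_cancel₀ hE0
  rw [SS, ← h1]
  ring

/-- For `N ≡ 2 (mod 4)`, `N ≥ 2`, and odd `m`, the Gauss sum
`G(N,m) = Σ_{j=0}^{N-1} q^{j(j+m)}` (with `q = exp(2πi/N)`) equals
`(1+i)·√N·exp(−πi m²/(2N))`; in particular it is nonzero. -/
theorem gauss_sum_eval (N : ℕ) (hN : 2 ≤ N) (hN4 : N % 4 = 2) (m : ℤ) (hm : Odd m) :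
    GaussG N m = (1 + Complex.I) * (Real.sqrt N : ℂ) *
        Complex.exp (-((Real.pi : ℂ) * Complex.I * (m : ℂ) ^ 2) / (2 * (N : ℂ))) ∧
    GaussG N m ≠ 0 := by
  have hform : GaussG N m = (1 + Complex.I) * (Real.sqrt N : ℂ) *
        Complex.exp (-((Real.pi : ℂ) * Complex.I * (m : ℂ) ^ 2) / (2 * (N : ℂ))) := by
    obtain ⟨h, rfl⟩ : ∃ h, N = 2 * (2 * h + 1) := ⟨N / 4, by omega⟩
    obtain ⟨k, rfl⟩ := hm
    rw [G_FF _ (by omega), ← SS_val, ← SS_one _ (by omega) k, SS]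
  refine ⟨hform, ?_⟩
  rw [hform]
  refine mul_ne_zero (mul_ne_zero ?_ ?_) (Complex.exp_ne_zero _)
  · intro h0
    have := congrArg Complex.re h0
    simp at this
  · have : 0 < Real.sqrt N := Real.sqrt_pos.mpr (by exact_mod_cast (by omega : 0 < N))
    exact_mod_cast this.ne'
end

section
/- Let n ≥ 1 and let N ≡ 2 (mod 4) with N ≥ 2. Then Σ_{μ∈X_N} q^{(μ,μ+2ρ)} = Π_{k=0}^{n−1} (1+i)·√N·exp(−πi(2k+1)²/(2N)). In particular this sum is nonzero. -/
open Complex Finset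

open Filter Topology HurwitzZeta in
theorem theta_split (M : ℕ) (hM : 0 < M) (he : Even M) (t : ℝ) (ht : 0 < t) :
    jacobiTheta (1 / M + I * t / M ^ 2) =
      ∑ r : Fin M, Complex.exp (Real.pi * I * (r : ℕ) ^ 2 / M) *
        (evenKernel (((r : ℕ) / M : ℝ) : UnitAddCircle) t : ℂ) := by
  have : NeZero M := ⟨hM.ne'⟩
  have hM0 : (M : ℂ) ≠ 0 := by exact_mod_cast hM.ne'
  set τ : ℂ := 1 / M + I * t / M ^ 2 with hτ
  have him : 0 < τ.im := by
    have : τ = ((1 / M : ℝ) : ℂ) + ((t / M ^ 2 : ℝ) : ℂ) * I := by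
      rw [hτ]; push_cast; ring
    rw [this]
    simp only [add_im, ofReal_im, mul_im, ofReal_re, I_im, I_re]
    have : (0 : ℝ) < M := by exact_mod_cast hM
    have : 0 < t / (M : ℝ) ^ 2 := by positivity
    linarith
  have h1 := hasSum_jacobiTheta₂_term 0 him
  rw [← jacobiTheta_eq_jacobiTheta₂] at h1
  rw [← ((Equiv.prodComm _ _).trans (Int.divModEquiv M).symm).hasSum_iff] at h1
  have h2 : ∀ r : Fin M, HasSum (fun k : ℤ => (fun n : ℤ => jacobiTheta₂_term n 0 τ)
      (((Equiv.prodComm _ _).trans (Int.divModEquiv M).symm) (r, k)))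
      (Complex.exp (Real.pi * I * (r : ℕ) ^ 2 / M) *
        (evenKernel (((r : ℕ) / M : ℝ) : UnitAddCircle) t : ℂ)) := by
    intro r
    have h3 := hasSum_ofReal.mpr (hasSum_int_evenKernel ((r : ℕ) / M : ℝ) ht)
    refine (h3.mul_left (Complex.exp (Real.pi * I * (r : ℕ) ^ 2 / M))).congr_fun fun k => ?_
    simp only [Equiv.trans_apply, Equiv.prodComm_apply, Prod.swap_prod_mk, Int.divModEquiv,
      Equiv.coe_fn_symm_mk, jacobiTheta₂_term]
    obtain ⟨L, hL⟩ := he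
    have hML : (M : ℂ) = 2 * L := by rw [hL]; push_cast; ring
    push_cast
    rw [← Complex.exp_add, Complex.exp_eq_exp_iff_exists_int]
    refine ⟨k * r + k ^ 2 * L, ?_⟩
    push_cast
    rw [hτ]
    have hh : (L : ℂ) = M / 2 := by rw [hML]; ring
    rw [hh]
    field_simp
    ring_nf
    simp only [I_sq]
    ring
  have h4 := h1.prod_fiberwise h2
  exact h4.unique (hasSum_fintype _)

theorem theta_fe (τ : ℂ) :
    jacobiTheta τ = 1 / (-I * τ) ^ (1 / 2 : ℂ) * jacobiTheta (-1 / τ) := by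
  rw [jacobiTheta_eq_jacobiTheta₂, jacobiTheta_eq_jacobiTheta₂, jacobiTheta₂_functional_equation]
  simp

theorem theta_add_two_mul (L : ℕ) (τ : ℂ) : jacobiTheta (τ + 2 * L) = jacobiTheta τ := by
  induction L with
  | zero => simp
  | succ k ih => rw [← ih, ← jacobiTheta_two_add (τ + 2 * k)]; congr 1; push_cast; ring

theorem theta_trans (M : ℕ) (hM : 0 < M) (he : Even M) (t : ℝ) (ht : 0 < t) :
    jacobiTheta (1 / M + I * t / M ^ 2) =
      1 / (-I * (1 / M + I * t / M ^ 2)) ^ (1 / 2 : ℂ) *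
      (1 / ((t ^ (1 / 2 : ℝ) : ℝ) * (M / (M + I * t)) ^ (1 / 2 : ℂ)) *
        jacobiTheta (-1 / M + I * (1 / t : ℝ))) := by
  have hM0 : (M : ℂ) ≠ 0 := by exact_mod_cast hM.ne'
  have ht0 : (t : ℂ) ≠ 0 := by exact_mod_cast ht.ne'
  have hMt : (M : ℂ) + I * t ≠ 0 := by
    intro h
    have := congrArg im h
    simp at this
    exact ht.ne' this
  obtain ⟨L, hL⟩ := he
  have hML : (M : ℂ) = 2 * L := by rw [hL]; push_cast; ring
  rw [theta_fe]
  congr 1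
  rw [← theta_add_two_mul L, ← hML]
  have e1 : (-1 / (1 / M + I * t / M ^ 2) + M : ℂ) = I * t * M / (M + I * t) := by
    have : (1 / M + I * t / M ^ 2 : ℂ) = (M + I * t) / M ^ 2 := by field_simp
    rw [this]; field_simp; ring
  rw [e1, theta_fe]
  have e2 : -I * (I * t * M / (M + I * t)) = (t : ℂ) * (M / (M + I * t)) := by
    field_simp; simp
  have e3 : -1 / (I * t * M / (M + I * t)) = (-1 / M + I * (1 / t : ℝ) : ℂ) := by
    push_cast; field_simp; ring_nf; simp
  rw [e2, e3]
  congr 2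
  have hq : (M : ℂ) / (M + I * t) ≠ 0 := div_ne_zero hM0 hMt
  rw [cpow_def_of_ne_zero (mul_ne_zero ht0 hq), log_ofReal_mul ht hq, add_mul, Complex.exp_add,
    cpow_def_of_ne_zero hq, ofReal_cpow ht.le, cpow_def_of_ne_zero ht0, ofReal_log ht.le]
  norm_num

open Filter Topology in
theorem tendsto_theta (c : ℝ) :
    Tendsto (fun s : ℝ => jacobiTheta (c + I * s)) atTop (𝓝 1) := by
  have h : Tendsto (fun s : ℝ => (c + I * s : ℂ)) atTop (comap im atTop) := by
    rw [tendsto_comap_iff]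
    have : (im ∘ fun s : ℝ => (c + I * s : ℂ)) = id := by
      ext s; simp
    rw [this]; exact tendsto_id
  have h1 := isBigO_at_im_infty_jacobiTheta_sub_one.comp_tendsto h
  have h2 : Tendsto (fun s : ℝ => Real.exp (-Real.pi * s)) atTop (𝓝 0) := by
    refine Real.tendsto_exp_atBot.comp ?_
    exact tendsto_id.const_mul_atTop_of_neg (by linarith [Real.pi_pos])
  have h3 := h1.trans_tendsto (by simpa [Function.comp_def] using h2)
  have := h3.add_const 1
  simpa [Function.comp_def] using this

open Filter Topology HurwitzZeta in
theorem tendsto_cosK (a : UnitAddCircle) :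
    Tendsto (fun s : ℝ => (cosKernel a s : ℂ)) atTop (𝓝 1) := by
  obtain ⟨p, hp, h1⟩ := isBigO_atTop_cosKernel_sub a
  have h2 : Tendsto (fun s : ℝ => Real.exp (-p * s)) atTop (𝓝 0) := by
    refine Real.tendsto_exp_atBot.comp ?_
    exact tendsto_id.const_mul_atTop_of_neg (by linarith)
  have h3 := (h1.trans_tendsto h2).add_const 1
  simp only [sub_add_cancel, zero_add] at h3
  exact_mod_cast (continuous_ofReal.tendsto 1).comp h3

open Filter Topology HurwitzZeta in
theorem gauss_even (M : ℕ) (hM : 0 < M) (he : Even M) :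
    ∑ r : Fin M, Complex.exp (Real.pi * I * (r : ℕ) ^ 2 / M) = 1 / (-I * (1 / M)) ^ (1 / 2 : ℂ) := by
  have hM0 : (M : ℂ) ≠ 0 := by exact_mod_cast hM.ne'
  have hMpos : (0 : ℝ) < M := by exact_mod_cast hM
  have key : ∀ t : ℝ, 0 < t →
      ∑ r : Fin M, Complex.exp (Real.pi * I * (r : ℕ) ^ 2 / M) *
        (cosKernel (((r : ℕ) / M : ℝ) : UnitAddCircle) t⁻¹ : ℂ) =
      1 / (-I * (1 / M + I * t / M ^ 2)) ^ (1 / 2 : ℂ) *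
      (1 / (M / (M + I * t)) ^ (1 / 2 : ℂ)) *
        jacobiTheta ((-1 / M : ℝ) + I * (t⁻¹ : ℝ)) := by
    intro t ht
    have h := (theta_split M hM he t ht).symm.trans (theta_trans M hM he t ht)
    have hr : ((t ^ (1 / 2 : ℝ) : ℝ) : ℂ) ≠ 0 := by
      exact_mod_cast (Real.rpow_pos_of_pos ht _).ne'
    simp_rw [evenKernel_functional_equation] at h
    have h5 := congrArg (fun z => ((t ^ (1 / 2 : ℝ) : ℝ) : ℂ) * z) h
    simp only [Finset.mul_sum] at h5
    convert h5 using 1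
    · refine Finset.sum_congr rfl fun r _ => ?_
      rw [ofReal_mul, ofReal_div, ofReal_one, one_div t]
      field_simp
    · rw [one_div t]
      push_cast
      have : ∀ a b c d : ℂ, a ≠ 0 → b * (1 / c) * d = a * (b * (1 / (a * c) * d)) := by
        intro a b c d ha
        rw [one_div, one_div, mul_inv]
        field_simp
      exact this _ _ _ _ (by exact_mod_cast hr)
  have hinv : Tendsto (fun t : ℝ => t⁻¹) (𝓝[>] 0) atTop := tendsto_inv_nhdsGT_zero
  have L1 : Tendsto (fun t : ℝ => ∑ r : Fin M, Complex.exp (Real.pi * I * (r : ℕ) ^ 2 / M) *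
        (cosKernel (((r : ℕ) / M : ℝ) : UnitAddCircle) t⁻¹ : ℂ)) (𝓝[>] 0)
        (𝓝 (∑ r : Fin M, Complex.exp (Real.pi * I * (r : ℕ) ^ 2 / M) * 1)) :=
    tendsto_finsetSum _ fun r _ => ((tendsto_cosK _).comp hinv).const_mul _
  have c1 : ContinuousAt (fun t : ℝ => 1 / (-I * (1 / M + I * t / M ^ 2) : ℂ) ^ (1 / 2 : ℂ)) 0 := by
    have hs : (-I * (1 / M + I * (0 : ℝ) / M ^ 2) : ℂ) ∈ slitPlane := by
      right
      have : (-I * (1 / M + I * (0 : ℝ) / M ^ 2) : ℂ) = ((-(1 / M) : ℝ) : ℂ) * I := by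
        push_cast; ring
      rw [this]; simp; exact hM.ne'
    refine ContinuousAt.div continuousAt_const ?_ ?_
    · refine ContinuousAt.cpow (by fun_prop) continuousAt_const hs
    · rw [Ne, cpow_eq_zero_iff, not_and_or]
      exact Or.inl (slitPlane_ne_zero hs)
  have c2 : ContinuousAt (fun t : ℝ => 1 / (M / (M + I * t) : ℂ) ^ (1 / 2 : ℂ)) 0 := by
    have hs : (M / (M + I * (0 : ℝ)) : ℂ) = 1 := by simp [hM0]
    refine ContinuousAt.div continuousAt_const ?_ ?_
    · refine ContinuousAt.cpow ?_ continuousAt_const (by rw [hs]; simp)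
      refine ContinuousAt.div continuousAt_const (by fun_prop) (by simp [hM0])
    · rw [hs]; simp
  have L2 := ((c1.tendsto.mono_left nhdsWithin_le_nhds).mul
    (c2.tendsto.mono_left nhdsWithin_le_nhds)).mul ((tendsto_theta (-1 / M)).comp hinv)
      (x := 𝓝[>] (0 : ℝ))
  have L3 := L1.congr' (by
    filter_upwards [self_mem_nhdsWithin] with t ht
    exact key t ht)
  have := tendsto_nhds_unique L3 L2
  simpa [hM0] using this

theorem gauss_val (N : ℕ) (hN : 0 < N) :
    1 / (-I * (1 / (2 * N : ℕ))) ^ (1 / 2 : ℂ) = (1 + I) * (Real.sqrt N : ℂ) := by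
  have hNpos : (0 : ℝ) < N := by exact_mod_cast hN
  have hp : (0 : ℝ) < 1 / (2 * N) := by positivity
  have e1 : (-I * (1 / (2 * N : ℕ)) : ℂ) = ((1 / (2 * N) : ℝ) : ℂ) * (-I) := by
    push_cast; ring
  have hI : (-I : ℂ) ≠ 0 := neg_ne_zero.mpr I_ne_zero
  have hpc : ((1 / (2 * N) : ℝ) : ℂ) ≠ 0 := by exact_mod_cast hp.ne'
  rw [e1, cpow_def_of_ne_zero (mul_ne_zero hpc hI), log_ofReal_mul hp hI, log_neg_I, add_mul,
    Complex.exp_add]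
  have e2 : Complex.exp (((Real.log (1 / (2 * N)) : ℝ) : ℂ) * (1 / 2)) =
      ((Real.sqrt (1 / (2 * N)) : ℝ) : ℂ) := by
    rw [Real.sqrt_eq_rpow, Real.rpow_def_of_pos hp]
    push_cast; rfl
  have e3 : Complex.exp (-(Real.pi / 2) * I * (1 / 2)) =
      ((Real.sqrt 2 / 2 : ℝ) : ℂ) * (1 - I) := by
    have : (-(Real.pi / 2) * I * (1 / 2) : ℂ) = ((-(Real.pi / 4) : ℝ) : ℂ) * I := by
      push_cast; ring
    rw [this, exp_mul_I, ← ofReal_cos, ← ofReal_sin, Real.cos_neg, Real.sin_neg,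
      Real.cos_pi_div_four, Real.sin_pi_div_four]
    push_cast; ring
  rw [e2, e3]
  have e4 : Real.sqrt (1 / (2 * N)) = 1 / (Real.sqrt 2 * Real.sqrt N) := by
    rw [Real.sqrt_div zero_le_one, Real.sqrt_one, Real.sqrt_mul zero_le_two]
  rw [e4]
  have h2 : (Real.sqrt 2 : ℂ) ≠ 0 := by
    exact_mod_cast (Real.sqrt_pos.mpr zero_lt_two).ne'
  have hn : (Real.sqrt N : ℂ) ≠ 0 := by
    exact_mod_cast (Real.sqrt_pos.mpr hNpos).ne'
  have hi : (1 - I : ℂ) ≠ 0 := by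
    intro h
    have := congrArg re h
    simp at this
  push_cast
  field_simp
  linear_combination I_sq

/-- `exp(πi k²/(2N))`. -/
noncomputable def Fexp (N k : ℕ) : ℂ := Complex.exp (Real.pi * I * (k : ℂ) ^ 2 / (2 * N : ℕ))

theorem Fexp_period (N k : ℕ) (hN : 0 < N) : Fexp N (k + 2 * N) = Fexp N k := by
  have hN0 : (N : ℂ) ≠ 0 := by exact_mod_cast hN.ne'
  rw [Fexp, Fexp, Complex.exp_eq_exp_iff_exists_int]
  refine ⟨k + N, ?_⟩
  push_cast
  field_simp
  ring

theorem sum_even_odd (f : ℕ → ℂ) (N : ℕ) :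
    ∑ k ∈ range (2 * N), f k = ∑ j ∈ range N, f (2 * j) + ∑ j ∈ range N, f (2 * j + 1) := by
  induction N with
  | zero => simp
  | succ k ih =>
    rw [show 2 * (k + 1) = 2 * k + 1 + 1 by ring, sum_range_succ, sum_range_succ, ih,
      sum_range_succ, sum_range_succ]
    ring

theorem sum_even_zero (N : ℕ) (hN4 : N % 4 = 2) : ∑ j ∈ range N, Fexp N (2 * j) = 0 := by
  obtain ⟨L, hL⟩ : ∃ L, N = (2 * L + 1) + (2 * L + 1) := ⟨N / 4, by omega⟩
  have h : ∀ j, Fexp N (2 * (2 * L + 1 + j)) = - Fexp N (2 * j) := by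
    intro j
    have hL0 : (2 * L + 1 : ℂ) ≠ 0 := by exact_mod_cast (by omega : 2 * L + 1 ≠ 0)
    have hNc : (N : ℂ) = 2 * (2 * L + 1) := by rw [hL]; push_cast; ring
    have : -Fexp N (2 * j) = Complex.exp (Real.pi * I) * Fexp N (2 * j) := by
      rw [exp_pi_mul_I]; ring
    rw [this, Fexp, Fexp, ← Complex.exp_add, Complex.exp_eq_exp_iff_exists_int]
    refine ⟨j + L, ?_⟩
    push_cast
    rw [hNc]
    field_simp
    ring
  rw [show range N = range ((2 * L + 1) + (2 * L + 1)) by rw [← hL], sum_range_add]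
  simp_rw [h]
  rw [sum_neg_distrib]
  ring

theorem sum_shift (N : ℕ) (hN : 0 < N) (k : ℕ) :
    ∑ j ∈ range N, Fexp N (2 * j + 1 + 2 * k) = ∑ j ∈ range N, Fexp N (2 * j + 1) := by
  induction k with
  | zero => simp
  | succ k ih =>
    rw [← ih]
    have h1 := sum_range_succ (fun j => Fexp N (2 * j + 1 + 2 * k)) N
    have h2 := sum_range_succ' (fun j => Fexp N (2 * j + 1 + 2 * k)) N
    have h3 : Fexp N (2 * N + 1 + 2 * k) = Fexp N (2 * 0 + 1 + 2 * k) := by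
      rw [← Fexp_period N (2 * 0 + 1 + 2 * k) hN]; congr 1; ring
    rw [h1, h3] at h2
    have h4 := add_right_cancel h2
    rw [h4]
    refine sum_congr rfl fun j _ => ?_
    congr 1; ring

theorem factor_eval (N : ℕ) (hN : 0 < N) (hN4 : N % 4 = 2) (k : ℕ) :
    ∑ a : Fin N, qp N (((a : ℕ) : ℚ) * (((a : ℕ) : ℚ) + (2 * k + 1))) =
      (1 + I) * (Real.sqrt N : ℂ) *
        Complex.exp (-((Real.pi : ℂ) * I * ((2 * k + 1 : ℕ) : ℂ) ^ 2) / (2 * (N : ℂ))) := by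
  have hN0 : (N : ℂ) ≠ 0 := by exact_mod_cast hN.ne'
  have h1 := gauss_even (2 * N) (by omega) (even_two_mul N)
  rw [gauss_val N hN, Fin.sum_univ_eq_sum_range
    (fun r : ℕ => Complex.exp (Real.pi * I * (r : ℂ) ^ 2 / (2 * N : ℕ)))] at h1
  have h2 := sum_even_odd (Fexp N) N
  rw [sum_even_zero N hN4, zero_add, ← sum_shift N hN k] at h2
  have h3 := h2.symm.trans h1
  rw [← h3, sum_mul, Fin.sum_univ_eq_sum_range
    (fun a : ℕ => qp N ((a : ℚ) * ((a : ℚ) + (2 * k + 1))))]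
  refine sum_congr rfl fun a _ => ?_
  rw [qp, Fexp, ← Complex.exp_add]
  congr 1
  push_cast
  field_simp
  ring

theorem qp_sum (N : ℕ) {n : ℕ} (f : Fin n → ℚ) : qp N (∑ j, f j) = ∏ j, qp N (f j) := by
  unfold qp
  rw [← Complex.exp_sum]
  congr 1
  push_cast
  rw [mul_sum, sum_div]

/-- For `n ≥ 1` and `N ≡ 2 (mod 4)`, `N ≥ 2`,
`Σ_{μ∈X_N} q^{(μ,μ+2ρ)} = Π_{k=0}^{n−1} (1+i)·√N·exp(−πi(2k+1)²/(2N))`,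
and in particular the sum is nonzero. -/
theorem sumX_eval (n N : ℕ) (hn : 1 ≤ n) (hN : 2 ≤ N) (hN4 : N % 4 = 2) :
    sumX n N N = (∏ k : Fin n, (1 + Complex.I) * (Real.sqrt N : ℂ) *
        Complex.exp (-((Real.pi : ℂ) * Complex.I * ((2 * (k : ℕ) + 1 : ℕ) : ℂ) ^ 2) /
          (2 * (N : ℂ)))) ∧
    sumX n N N ≠ 0 := by
  have hmain : sumX n N N = (∏ k : Fin n, (1 + Complex.I) * (Real.sqrt N : ℂ) *
        Complex.exp (-((Real.pi : ℂ) * Complex.I * ((2 * (k : ℕ) + 1 : ℕ) : ℂ) ^ 2) /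
          (2 * (N : ℂ)))) := by
    have h1 : ∀ k : Fin n, (1 + Complex.I) * (Real.sqrt N : ℂ) *
        Complex.exp (-((Real.pi : ℂ) * Complex.I * ((2 * (k : ℕ) + 1 : ℕ) : ℂ) ^ 2) /
          (2 * (N : ℂ))) =
        ∑ a : Fin N, qp N (((a : ℕ) : ℚ) * (((a : ℕ) : ℚ) + (2 * (k : ℕ) + 1))) :=
      fun k => (factor_eval N (by omega) hN4 k).symm
    rw [Finset.prod_congr rfl fun k _ => h1 k, ← Equiv.prod_comp Fin.revPerm, prod_univ_sum,
      Fintype.piFinset_univ]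
    unfold sumX
    refine sum_congr rfl fun mu _ => ?_
    unfold dotp
    rw [qp_sum]
    refine Finset.prod_congr rfl fun j _ => ?_
    congr 1
    have hj : ((n - ((j : ℕ) + 1) : ℕ) : ℚ) = (n : ℚ) - ((j : ℕ) + 1) := by
      rw [Nat.cast_sub j.2]; push_cast; ring
    simp only [finC, rhoV, Pi.add_apply, Pi.smul_apply, Fin.revPerm_apply, Fin.val_rev, hj]
    rw [nsmul_eq_mul]
    push_cast
    ring
  refine ⟨hmain, ?_⟩
  rw [hmain, Finset.prod_ne_zero_iff]
  intro k _
  refine mul_ne_zero (mul_ne_zero ?_ ?_) (Complex.exp_ne_zero _)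
  · intro h
    have := congrArg re h
    simp at this
  · have : (0 : ℝ) < N := by exact_mod_cast (by omega : 0 < N)
    exact_mod_cast (Real.sqrt_pos.mpr this).ne'
end
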